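/- Let k ≥ 1, let q₀,…,q_{4k−1} ∈ ℝ² be the vertices of a regular 4k-gon with center q (i.e., qⱼ = q + r·(cos(2πj/(4k) + θ), sin(2πj/(4k) + θ)), r > 0). Then I({q, q₀,…,q_{4k−1}}) = {2k+1, 4k+1}. -/

import Mathlib

/-- The non-vertical line associated to a point `(A, B)`:
`f(A,B) = {(x,y) : y + A·x + B = 0}`. -/
def fline (p : ℝ × ℝ) : Set (ℝ × ℝ) :=
  {q : ℝ × ℝ | q.2 + p.1 * q.1 + p.2 = 0}

/-- A line in `ℝ²`: a set of the form `{a + t • v : t ∈ ℝ}` with `v ≠ 0`. -/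
def IsLine (L : Set (ℝ × ℝ)) : Prop :=
  ∃ a v : ℝ × ℝ, v ≠ 0 ∧ L = {p : ℝ × ℝ | ∃ t : ℝ, p = a + t • v}

/-- A vertical line: a set of the form `{(a, y) : y ∈ ℝ}`. -/
def IsVerticalLine (L : Set (ℝ × ℝ)) : Prop :=
  ∃ a : ℝ, L = {p : ℝ × ℝ | p.1 = a}

/-- Two lines are parallel if they have a common direction vector
(equivalently, their direction vectors are proportional). -/
def Par (L M : Set (ℝ × ℝ)) : Prop :=
  ∃ (a b v : ℝ × ℝ), v ≠ 0 ∧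
    L = {p : ℝ × ℝ | ∃ t : ℝ, p = a + t • v} ∧
    M = {p : ℝ × ℝ | ∃ t : ℝ, p = b + t • v}

/-- `ISet Q` is the set of all cardinalities `|G|`, where `G` ranges over finite
families of pairwise parallel lines covering `Q`, each member of which meets `Q`. -/
def ISet (Q : Set (ℝ × ℝ)) : Set ℕ :=
  {n : ℕ | ∃ G : Finset (Set (ℝ × ℝ)), G.card = n ∧
    (∀ L ∈ G, IsLine L) ∧
    (∀ L ∈ G, ∀ M ∈ G, Par L M) ∧
    Q ⊆ ⋃₀ (↑G : Set (Set (ℝ × ℝ))) ∧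
    (∀ L ∈ G, (L ∩ Q).Nonempty)}


/-- linear functional vanishing on `v` -/
noncomputable def FF (v p : ℝ × ℝ) : ℝ := v.1 * p.2 - v.2 * p.1

lemma FF_par {v w : ℝ × ℝ} (hv : v ≠ 0) (h : FF v w = 0) : ∃ c : ℝ, w = c • v := by
  obtain ⟨v1, v2⟩ := v
  obtain ⟨w1, w2⟩ := w
  simp only [FF] at h
  by_cases h1 : v1 = 0
  · have h2 : v2 ≠ 0 := by
      rintro rfl
      exact hv (by rw [h1]; rfl)
    refine ⟨w2 / v2, ?_⟩
    subst h1
    have : w1 = 0 := by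
      have : v2 * w1 = 0 := by linarith
      exact (mul_eq_zero.1 this).resolve_left h2
    ext <;> simp [this, h2]
  · refine ⟨w1 / v1, ?_⟩
    ext
    · simp [h1]
    · simp only [Prod.smul_mk, smul_eq_mul]
      field_simp
      linarith

lemma line_eq {v : ℝ × ℝ} (hv : v ≠ 0) (a : ℝ × ℝ) :
    {p : ℝ × ℝ | ∃ t : ℝ, p = a + t • v} = {p | FF v p = FF v a} := by
  ext p
  simp only [Set.mem_ofPred_eq]
  constructor
  · rintro ⟨t, rfl⟩
    simp only [FF, Prod.fst_add, Prod.snd_add, Prod.smul_fst, Prod.smul_snd, smul_eq_mul]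
    ring
  · intro h
    obtain ⟨c, hc⟩ := FF_par (w := p - a) hv (by
      simp only [FF, Prod.fst_sub, Prod.snd_sub] at h ⊢
      linarith)
    exact ⟨c, by rw [← hc]; abel⟩

lemma inj_fib (v : ℝ × ℝ) (Q : Set (ℝ × ℝ)) :
    Set.InjOn (fun c : ℝ => {p : ℝ × ℝ | FF v p = c}) (FF v '' Q) := by
  rintro _ ⟨x, hx, rfl⟩ _ ⟨y, hy, rfl⟩ h
  have : x ∈ {p : ℝ × ℝ | FF v p = FF v x} := rfl
  simp only at h
  rw [h] at this
  exact this

lemma ISet_iff (Q : Set (ℝ × ℝ)) (hQ : Q.Finite) (hne : Q.Nonempty) (n : ℕ) :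
    n ∈ ISet Q ↔ ∃ v : ℝ × ℝ, v ≠ 0 ∧ (FF v '' Q).ncard = n := by
  constructor
  · rintro ⟨G, hn, hl, hp, hc, hm⟩
    obtain ⟨x, hx⟩ := hne
    obtain ⟨L, hL, hxL⟩ := hc hx
    obtain ⟨a, v, hv, hLe⟩ := hl L hL
    refine ⟨v, hv, ?_⟩
    have key : ∀ M ∈ G, ∃ b, M = {p | FF v p = FF v b} := by
      intro M hM
      obtain ⟨a', b, w, hw, h1, h2⟩ := hp L hL M hM
      have ha' : a' ∈ L := by rw [h1]; exact ⟨0, by simp⟩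
      have haw : a' + w ∈ L := by rw [h1]; exact ⟨1, by simp⟩
      rw [hLe, line_eq hv] at ha' haw
      simp only [Set.mem_ofPred_eq] at ha' haw
      obtain ⟨c, hcw⟩ := FF_par (w := w) hv (by
        simp only [FF, Prod.fst_add, Prod.snd_add] at ha' haw ⊢
        linarith)
      have hc0 : c ≠ 0 := by
        rintro rfl
        exact hw (by simpa using hcw)
      refine ⟨b, ?_⟩
      rw [h2, line_eq hw]
      have : ∀ p, FF w p = c * FF v p := by
        intro p
        rw [hcw]
        simp only [FF, Prod.smul_fst, Prod.smul_snd, smul_eq_mul]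
        ring
      ext p
      simp only [Set.mem_ofPred_eq, this]
      exact ⟨fun h => mul_left_cancel₀ hc0 h, fun h => by rw [h]⟩
    rw [← hn, ← Set.ncard_coe_finset, ← Set.InjOn.ncard_image (inj_fib v Q)]
    congr 1
    ext M
    constructor
    · rintro ⟨_, ⟨y, hy, rfl⟩, rfl⟩
      obtain ⟨N, hN, hyN⟩ := hc hy
      obtain ⟨b, hb⟩ := key N hN
      rw [hb] at hyN
      have hyN : FF v y = FF v b := hyN
      simp only
      rw [hyN, ← hb]
      exact hN
    · intro hM
      obtain ⟨b, hb⟩ := key M hM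
      obtain ⟨y, hyM, hy⟩ := hm M hM
      rw [hb] at hyM
      have hyM : FF v y = FF v b := hyM
      exact ⟨_, ⟨y, hy, rfl⟩, by simp only; rw [hyM, ← hb]⟩
  · rintro ⟨v, hv, hn⟩
    have hfin := (hQ.image (FF v)).image (fun c : ℝ => {p : ℝ × ℝ | FF v p = c})
    refine ⟨hfin.toFinset, ?_, ?_, ?_, ?_, ?_⟩
    · rw [← Set.ncard_eq_toFinset_card _ hfin, Set.InjOn.ncard_image (inj_fib v Q), hn]
    · intro L hL
      rw [Set.Finite.mem_toFinset] at hL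
      obtain ⟨_, ⟨y, hy, rfl⟩, rfl⟩ := hL
      exact ⟨y, v, hv, (line_eq hv y).symm⟩
    · intro L hL M hM
      rw [Set.Finite.mem_toFinset] at hL hM
      obtain ⟨_, ⟨y, hy, rfl⟩, rfl⟩ := hL
      obtain ⟨_, ⟨z, hz, rfl⟩, rfl⟩ := hM
      exact ⟨y, z, v, hv, (line_eq hv y).symm, (line_eq hv z).symm⟩
    · intro y hy
      exact ⟨{p | FF v p = FF v y}, by
        rw [Set.Finite.coe_toFinset]
        exact ⟨_, ⟨y, hy, rfl⟩, rfl⟩, rfl⟩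
    · intro L hL
      rw [Set.Finite.mem_toFinset] at hL
      obtain ⟨_, ⟨y, hy, rfl⟩, rfl⟩ := hL
      exact ⟨y, rfl, hy⟩

/-- projected values -/
noncomputable def GG (k : ℕ) (β : ℝ) (j : ℕ) : ℝ :=
  Real.cos (2 * Real.pi * (j : ℝ) / (4 * (k : ℝ)) + β)

/-- the value set -/
noncomputable def VS (k : ℕ) (β : ℝ) : Set ℝ :=
  insert 0 (Set.range fun j : Fin (4 * k) => GG k β j)

lemma VS_generic (k : ℕ) (hk : 1 ≤ k) (β : ℝ)
    (h : ¬ ∃ s : ℤ, β = Real.pi * s / (4 * k)) : (VS k β).ncard = 4 * k + 1 := by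
  have hk0 : (k : ℝ) ≠ 0 := by positivity
  have hpi := Real.pi_ne_zero
  have h0 : (0 : ℝ) ∉ (Set.range fun j : Fin (4 * k) => GG k β j) := by
    rintro ⟨j, hj⟩
    simp only [GG] at hj
    obtain ⟨m, hm⟩ := Real.cos_eq_zero_iff.1 hj
    apply h
    refine ⟨(2 * m + 1) * (2 * k) - 2 * (j : ℕ), ?_⟩
    push_cast
    rw [← eq_sub_iff_add_eq'] at hm
    rw [hm]
    field_simp
    ring
  have hinj : Function.Injective (fun j : Fin (4 * k) => GG k β j) := by
    intro i j hij
    simp only [GG] at hij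
    obtain ⟨m, hm | hm⟩ := Real.cos_eq_cos_iff.1 hij
    · have h1 : ((j : ℕ) : ℝ) = 4 * k * m + (i : ℕ) := by
        field_simp at hm
        have h2 : (Real.pi * 2) * ((j : ℕ) : ℝ) = (Real.pi * 2) * (4 * k * m + (i : ℕ)) := by
          linarith
        exact mul_left_cancel₀ (by positivity) h2
      have h2 : ((j : ℕ) : ℤ) = 4 * k * m + (i : ℕ) := by exact_mod_cast h1
      have hi := i.2
      have hj := j.2
      have e : ((j : ℕ) : ℤ) % ((4 * k : ℕ) : ℤ) = ((i : ℕ) : ℤ) % ((4 * k : ℕ) : ℤ) := by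
        rw [h2]; push_cast
        rw [add_comm, Int.add_mul_emod_self_left]
      rw [Int.emod_eq_of_lt (by omega) (by omega), Int.emod_eq_of_lt (by omega) (by omega)] at e
      exact Fin.ext (by omega)
    · exfalso
      apply h
      refine ⟨4 * k * m - (i : ℕ) - (j : ℕ), ?_⟩
      push_cast
      field_simp at hm ⊢
      linarith
  rw [VS, Set.ncard_insert_of_notMem h0 (Set.finite_range _), Set.ncard_range_of_injective hinj]
  simp

/-- cosine values at multiples of the half step -/
noncomputable def CC (k : ℕ) (t : ℤ) : ℝ := Real.cos (Real.pi * t / (4 * k))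

lemma CC_period (k : ℕ) (hk : 1 ≤ k) (t m : ℤ) : CC k (t + 8 * k * m) = CC k t := by
  have hk0 : (k : ℝ) ≠ 0 := by positivity
  simp only [CC]
  rw [← Real.cos_add_int_mul_two_pi (Real.pi * t / (4 * k)) m]
  congr 1
  push_cast
  field_simp
  ring

lemma CC_neg (k : ℕ) (t : ℤ) : CC k (-t) = CC k t := by
  simp only [CC]
  rw [← Real.cos_neg]
  congr 1
  push_cast
  ring

lemma CC_inj (k : ℕ) (hk : 1 ≤ k) {t u : ℤ} (ht : 0 ≤ t) (ht' : t ≤ 4 * k) (hu : 0 ≤ u)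
    (hu' : u ≤ 4 * k) (h : CC k t = CC k u) : t = u := by
  have hk0 : (0 : ℝ) < k := by positivity
  have hpi := Real.pi_pos
  have aux : ∀ x : ℤ, 0 ≤ x → x ≤ 4 * k → Real.pi * x / (4 * k) ∈ Set.Icc 0 Real.pi := by
    intro x h0 h1
    have h0 : (0 : ℝ) ≤ x := by exact_mod_cast h0
    have h1 : (x : ℝ) ≤ 4 * k := by exact_mod_cast h1
    refine ⟨by positivity, ?_⟩
    rw [div_le_iff₀ (by positivity)]
    exact mul_le_mul_of_nonneg_left h1 hpi.le
  have := Real.injOn_cos (aux t ht ht') (aux u hu hu') h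
  field_simp at this
  exact_mod_cast this

lemma CC_red (k : ℕ) (hk : 1 ≤ k) (t : ℤ) :
    ∃ u : ℤ, 0 ≤ u ∧ u ≤ 4 * k ∧ u % 2 = t % 2 ∧ CC k u = CC k t := by
  have hd := Int.emod_add_mul_ediv t (8 * k)
  have h0 := Int.emod_nonneg t (b := 8 * k) (by omega)
  have h1 := Int.emod_lt_of_pos t (b := 8 * k) (by omega)
  set x := t % (8 * k) with hx
  set m := t / (8 * k) with hm
  have e : CC k x = CC k t := by rw [← hd, CC_period k hk]
  have par : x % 2 = t % 2 := by
    have : t = x + 2 * (4 * k * m) := by linarith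
    rw [this]; simp
  by_cases hle : x ≤ 4 * k
  · exact ⟨x, h0, hle, par, e⟩
  · refine ⟨8 * k - x, by omega, by omega, by omega, ?_⟩
    rw [← e, ← CC_neg k x, ← CC_period k hk (-x) 1]
    congr 1; ring

lemma CC_zero (k : ℕ) (hk : 1 ≤ k) : CC k (2 * k) = 0 := by
  have hk0 : (k : ℝ) ≠ 0 := by positivity
  simp only [CC]
  rw [← Real.cos_pi_div_two]
  congr 1
  push_cast
  field_simp
  ring

lemma VS_eq (k : ℕ) (hk : 1 ≤ k) (s : ℤ) :
    VS k (Real.pi * s / (4 * k)) = insert 0 (CC k '' {t : ℤ | t % 2 = s % 2}) := by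
  have hk0 : (k : ℝ) ≠ 0 := by positivity
  have hG : ∀ j : ℕ, GG k (Real.pi * s / (4 * k)) j = CC k (2 * j + s) := by
    intro j
    simp only [GG, CC]
    congr 1
    push_cast
    field_simp
  rw [VS]
  congr 1
  ext y
  constructor
  · rintro ⟨j, rfl⟩
    exact ⟨2 * (j : ℕ) + s, by simp, (hG j).symm⟩
  · rintro ⟨t, ht, rfl⟩
    have ht : t % 2 = s % 2 := ht
    obtain ⟨w, hw⟩ : ∃ w, t = 2 * w + s := ⟨(t - s) / 2, by omega⟩
    have hd := Int.emod_add_mul_ediv w (4 * k)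
    have h0 := Int.emod_nonneg w (b := 4 * k) (by omega)
    have h1 := Int.emod_lt_of_pos w (b := 4 * k) (by omega)
    refine ⟨⟨(w % (4 * k)).toNat, by omega⟩, ?_⟩
    simp only [hG]
    rw [Int.toNat_of_nonneg h0, ← CC_period k hk _ (w / (4 * k))]
    congr 1
    rw [hw]
    linarith

lemma VS_special (k : ℕ) (hk : 1 ≤ k) (s : ℤ) :
    (VS k (Real.pi * s / (4 * k))).ncard = 2 * k + 1 := by
  rw [VS_eq k hk]
  rcases Int.emod_two_eq_zero_or_one s with hs | hs
  · have : insert 0 (CC k '' {t : ℤ | t % 2 = s % 2})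
        = Set.range (fun i : Fin (2 * k + 1) => CC k (2 * (i : ℕ))) := by
      ext y
      constructor
      · have main : ∀ t : ℤ, t % 2 = s % 2 →
            CC k t ∈ Set.range (fun i : Fin (2 * k + 1) => CC k (2 * (i : ℕ))) := by
          intro t ht
          obtain ⟨u, h0, h1, h2, h3⟩ := CC_red k hk t
          refine ⟨⟨(u / 2).toNat, by omega⟩, ?_⟩
          simp only
          rw [← h3]
          congr 1
          omega
        rintro (rfl | ⟨t, ht, rfl⟩)
        · rw [← CC_zero k hk]
          exact main _ (by omega)
        · exact main t ht
      · rintro ⟨i, rfl⟩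
        exact Or.inr ⟨_, by simp [hs], rfl⟩
    rw [this, Set.ncard_range_of_injective]
    · simp
    · intro i j h
      have := CC_inj k hk (by omega) (by omega) (by omega) (by omega) h
      exact Fin.ext (by omega)
  · have : CC k '' {t : ℤ | t % 2 = s % 2}
        = Set.range (fun i : Fin (2 * k) => CC k (2 * (i : ℕ) + 1)) := by
      ext y
      constructor
      · rintro ⟨t, ht, rfl⟩
        have ht : t % 2 = s % 2 := ht
        obtain ⟨u, h0, h1, h2, h3⟩ := CC_red k hk t
        refine ⟨⟨(u / 2).toNat, by omega⟩, ?_⟩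
        simp only
        rw [← h3]
        congr 1
        omega
      · rintro ⟨i, rfl⟩
        exact ⟨_, by simp only [Set.mem_ofPred_eq]; omega, rfl⟩
    rw [this, Set.ncard_insert_of_notMem _ (Set.finite_range _), Set.ncard_range_of_injective]
    · simp
    · intro i j h
      have := CC_inj k hk (by omega) (by omega) (by omega) (by omega) h
      exact Fin.ext (by omega)
    · rintro ⟨i, hi⟩
      rw [← CC_zero k hk] at hi
      have := CC_inj k hk (by omega) (by omega) (by omega) (by omega) hi
      omega

lemma proj_card (k : ℕ) (qc : ℝ × ℝ)
    (q : Fin (4 * k) → ℝ × ℝ) (r θ : ℝ) (hr : 0 < r)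
    (hq : ∀ j : Fin (4 * k), q j = qc + r •
      (Real.cos (2 * Real.pi * ((j : ℕ) : ℝ) / (4 * (k : ℝ)) + θ),
       Real.sin (2 * Real.pi * ((j : ℕ) : ℝ) / (4 * (k : ℝ)) + θ))) (ρ φ : ℝ) (hρ : 0 < ρ) :
    (FF (ρ * Real.cos φ, ρ * Real.sin φ) '' (insert qc (Set.range q))).ncard
      = (VS k (θ - φ - Real.pi / 2)).ncard := by
  set v : ℝ × ℝ := (ρ * Real.cos φ, ρ * Real.sin φ) with hv
  have hinj : Function.Injective (fun x : ℝ => FF v qc + r * ρ * x) := by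
    intro x y h
    have h : r * ρ * x = r * ρ * y := by simpa using h
    exact mul_left_cancel₀ (by positivity) h
  rw [← Set.ncard_image_of_injective (VS k _) hinj]
  congr 1
  rw [VS, Set.image_insert_eq, Set.image_insert_eq, ← Set.range_comp, ← Set.range_comp]
  congr 1
  · simp
  · congr 1
    funext j
    simp only [Function.comp, GG]
    rw [hq j]
    generalize 2 * Real.pi * ((j : ℕ) : ℝ) / (4 * (k : ℝ)) = α
    rw [show α + (θ - φ - Real.pi / 2) = (α + θ - φ) - Real.pi / 2 by ring,
      Real.cos_sub_pi_div_two, Real.sin_sub]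
    simp only [hv, FF, Prod.fst_add, Prod.snd_add, Prod.smul_mk, smul_eq_mul]
    ring

theorem statement_9 (k : ℕ) (hk : 1 ≤ k) (qc : ℝ × ℝ)
    (q : Fin (4 * k) → ℝ × ℝ) (r θ : ℝ) (hr : 0 < r)
    (hq : ∀ j : Fin (4 * k), q j = qc + r •
      (Real.cos (2 * Real.pi * ((j : ℕ) : ℝ) / (4 * (k : ℝ)) + θ),
       Real.sin (2 * Real.pi * ((j : ℕ) : ℝ) / (4 * (k : ℝ)) + θ))) :
    ISet (insert qc (Set.range q)) = {2 * k + 1, 4 * k + 1} := by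
  have hfin : (insert qc (Set.range q)).Finite := (Set.finite_range q).insert qc
  have hk0 : (k : ℝ) ≠ 0 := by positivity
  have hpi := Real.pi_ne_zero
  have hne : ∀ φ : ℝ, ((1 * Real.cos φ, 1 * Real.sin φ) : ℝ × ℝ) ≠ 0 := by
    intro φ h
    have h1 := congrArg Prod.fst h
    have h2 := congrArg Prod.snd h
    simp at h1 h2
    have := Real.sin_sq_add_cos_sq φ
    rw [h1, h2] at this
    norm_num at this
  ext n
  rw [ISet_iff _ hfin (Set.insert_nonempty _ _)]
  simp only [Set.mem_insert_iff, Set.mem_singleton_iff]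
  constructor
  · rintro ⟨v, hv, rfl⟩
    have hz : (⟨v.1, v.2⟩ : ℂ) ≠ 0 := by
      intro h
      apply hv
      have h1 := congrArg Complex.re h
      have h2 := congrArg Complex.im h
      exact Prod.ext h1 h2
    have h1 := Complex.norm_mul_cos_arg ⟨v.1, v.2⟩
    have h2 := Complex.norm_mul_sin_arg ⟨v.1, v.2⟩
    have e := proj_card k qc q r θ hr hq _ (Complex.arg ⟨v.1, v.2⟩) (norm_pos_iff.2 hz)
    rw [h1, h2] at e
    simp only [Prod.mk.eta] at e
    rw [e]
    by_cases h : ∃ s : ℤ, θ - Complex.arg ⟨v.1, v.2⟩ - Real.pi / 2 = Real.pi * s / (4 * k)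
    · obtain ⟨s, hs⟩ := h
      left
      rw [hs, VS_special k hk]
    · right
      exact VS_generic k hk _ h
  · rintro (rfl | rfl)
    · refine ⟨_, hne (θ - Real.pi / 2), ?_⟩
      rw [proj_card k qc q r θ hr hq 1 _ one_pos,
        show θ - (θ - Real.pi / 2) - Real.pi / 2 = Real.pi * ((0 : ℤ) : ℝ) / (4 * k) by
          push_cast; ring]
      exact VS_special k hk 0
    · refine ⟨_, hne (θ - Real.pi / 2 - Real.pi / (8 * k)), ?_⟩
      rw [proj_card k qc q r θ hr hq 1 _ one_pos]
      apply VS_generic k hk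
      rintro ⟨s, hs⟩
      rw [show θ - (θ - Real.pi / 2 - Real.pi / (8 * k)) - Real.pi / 2 = Real.pi / (8 * k) by
        ring] at hs
      field_simp at hs
      have h8 : (1 : ℝ) = 2 * s := by linarith
      have h9 : (1 : ℤ) = 2 * s := by exact_mod_cast h8
      omega
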